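/- Let G be a connected groupoid with finitely many morphisms, let M(γ) ∈ Matrix Γ Γ ℂ be the matrix of D(γ) in the delta basis, and set N := (number of objects of G) × (order of the isotropy group of an object). Define the star product of f₁, f₂ : Γ → ℂ by (f₁ ⋆ f₂)(γ) = Σ_{γ₁, γ₂ ∈ Γ} f₁(γ₁) · f₂(γ₂) · K(γ₁, γ₂, γ), with kernel K(γ₁, γ₂, γ) := (1/N) · Tr[M(γ₁) * M(γ₂) * M(γ)ᵀ]. Then K(γ₁, γ₂, γ) = 1 if γ₁ and γ₂ are composable with γ₁ ≫ γ₂ = γ, and 0 otherwise, and consequently f₁ ⋆ f₂ = f₁ ∗ f₂, i.e. the star product defined by this kernel coincides with the convolution product of the groupoid algebra. -/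

import Mathlib

open CategoryTheory

/-- The convolution product of the groupoid algebra of a finite groupoid `G`, on functions
on the type `Γ = Σ x y : G, x ⟶ y` of all morphisms. -/
noncomputable def groupoidConv {G : Type*} [Groupoid G] [Fintype G] [DecidableEq G]
    [∀ x y : G, Fintype (x ⟶ y)] [∀ x y : G, DecidableEq (x ⟶ y)]
    (f₁ f₂ : (Σ x y : G, x ⟶ y) → ℂ) : (Σ x y : G, x ⟶ y) → ℂ :=
  fun γ => ∑ x : G, ∑ y : G, ∑ z : G, ∑ a : x ⟶ y, ∑ b : y ⟶ z,
    if (⟨x, z, a ≫ b⟩ : Σ x y : G, x ⟶ y) = γ then f₁ ⟨x, y, a⟩ * f₂ ⟨y, z, b⟩ else 0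

/-- The delta (indicator) function of a morphism `γ`. -/
def groupoidDelta {G : Type*} [Groupoid G] [DecidableEq G]
    [∀ x y : G, DecidableEq (x ⟶ y)] (γ : Σ x y : G, x ⟶ y) :
    (Σ x y : G, x ⟶ y) → ℂ :=
  fun η => if η = γ then 1 else 0

theorem groupoidConv_add_right {G : Type*} [Groupoid G] [Fintype G] [DecidableEq G]
    [∀ x y : G, Fintype (x ⟶ y)] [∀ x y : G, DecidableEq (x ⟶ y)]
    (f g₁ g₂ : (Σ x y : G, x ⟶ y) → ℂ) :
    groupoidConv f (g₁ + g₂) = groupoidConv f g₁ + groupoidConv f g₂ := by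
  funext γ
  simp only [groupoidConv, Pi.add_apply, ← Finset.sum_add_distrib]
  refine Finset.sum_congr rfl fun x _ => Finset.sum_congr rfl fun y _ =>
    Finset.sum_congr rfl fun z _ => Finset.sum_congr rfl fun a _ =>
    Finset.sum_congr rfl fun b _ => ?_
  split_ifs <;> ring

theorem groupoidConv_smul_right {G : Type*} [Groupoid G] [Fintype G] [DecidableEq G]
    [∀ x y : G, Fintype (x ⟶ y)] [∀ x y : G, DecidableEq (x ⟶ y)]
    (c : ℂ) (f g : (Σ x y : G, x ⟶ y) → ℂ) :
    groupoidConv f (c • g) = c • groupoidConv f g := by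
  funext γ
  simp only [groupoidConv, Pi.smul_apply, smul_eq_mul, Finset.mul_sum]
  refine Finset.sum_congr rfl fun x _ => Finset.sum_congr rfl fun y _ =>
    Finset.sum_congr rfl fun z _ => Finset.sum_congr rfl fun a _ =>
    Finset.sum_congr rfl fun b _ => ?_
  split_ifs <;> ring

/-- Left convolution by the delta function of `γ`, as a linear operator: `D(γ) f := δ_γ ∗ f`. -/
noncomputable def groupoidD {G : Type*} [Groupoid G] [Fintype G] [DecidableEq G]
    [∀ x y : G, Fintype (x ⟶ y)] [∀ x y : G, DecidableEq (x ⟶ y)]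
    (γ : Σ x y : G, x ⟶ y) :
    ((Σ x y : G, x ⟶ y) → ℂ) →ₗ[ℂ] ((Σ x y : G, x ⟶ y) → ℂ) where
  toFun f := groupoidConv (groupoidDelta γ) f
  map_add' g₁ g₂ := groupoidConv_add_right _ g₁ g₂
  map_smul' c g := groupoidConv_smul_right c _ g

/-- The matrix `M(γ)` of the operator `D(γ)` in the standard (delta-function) basis of the
groupoid algebra. -/
noncomputable def groupoidM {G : Type*} [Groupoid G] [Fintype G] [DecidableEq G]
    [∀ x y : G, Fintype (x ⟶ y)] [∀ x y : G, DecidableEq (x ⟶ y)]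
    (γ : Σ x y : G, x ⟶ y) : Matrix (Σ x y : G, x ⟶ y) (Σ x y : G, x ⟶ y) ℂ :=
  LinearMap.toMatrix (Pi.basisFun ℂ (Σ x y : G, x ⟶ y))
    (Pi.basisFun ℂ (Σ x y : G, x ⟶ y)) (groupoidD γ)


section Helpers

variable {G : Type*} [Groupoid G] [Fintype G] [DecidableEq G]
    [∀ x y : G, Fintype (x ⟶ y)] [∀ x y : G, DecidableEq (x ⟶ y)]

theorem gaux_D_sum (x y : G) (a : x ⟶ y) (f : (Σ x y : G, x ⟶ y) → ℂ)
    (η : Σ x y : G, x ⟶ y) :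
    groupoidD ⟨x, y, a⟩ f η = ∑ z : G, ∑ b : y ⟶ z,
      if (⟨x, z, a ≫ b⟩ : Σ x y : G, x ⟶ y) = η then f ⟨y, z, b⟩ else 0 := by
  change groupoidConv (groupoidDelta _) f η = _
  unfold groupoidConv groupoidDelta
  rw [Finset.sum_eq_single x, Finset.sum_eq_single y]
  · refine Finset.sum_congr rfl fun z _ => ?_
    rw [Finset.sum_eq_single a]
    · simp
    · intro a' _ h
      simp [h]
    · simp
  · intro y' _ h
    refine Finset.sum_eq_zero fun z _ => Finset.sum_eq_zero fun a' _ =>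
      Finset.sum_eq_zero fun b _ => ?_
    have : (⟨x, y', a'⟩ : Σ x y : G, x ⟶ y) ≠ ⟨x, y, a⟩ := by
      intro e; cases e; exact h rfl
    simp only [if_neg this, zero_mul, ite_self]
  · simp
  · intro x' _ h
    refine Finset.sum_eq_zero fun y' _ => Finset.sum_eq_zero fun z _ =>
      Finset.sum_eq_zero fun a' _ => Finset.sum_eq_zero fun b _ => ?_
    have : (⟨x', y', a'⟩ : Σ x y : G, x ⟶ y) ≠ ⟨x, y, a⟩ := by
      intro e; cases e; exact h rfl
    simp only [if_neg this, zero_mul, ite_self]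
  · simp

theorem gaux_D_same (x y z : G) (a : x ⟶ y) (f : (Σ x y : G, x ⟶ y) → ℂ) (c : x ⟶ z) :
    groupoidD ⟨x, y, a⟩ f ⟨x, z, c⟩ = f ⟨y, z, Groupoid.inv a ≫ c⟩ := by
  rw [gaux_D_sum, Finset.sum_eq_single z, Finset.sum_eq_single (Groupoid.inv a ≫ c)]
  · simp
  · intro b _ h
    rw [if_neg]
    intro e
    apply h
    simp only [Sigma.mk.injEq, heq_eq_eq, true_and] at e
    simp [← e]
  · simp
  · intro z' _ h
    refine Finset.sum_eq_zero fun b _ => if_neg ?_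
    intro e; cases e; exact h rfl
  · simp

theorem gaux_D_ne (γ : Σ x y : G, x ⟶ y) (f : (Σ x y : G, x ⟶ y) → ℂ)
    (η : Σ x y : G, x ⟶ y) (h : η.1 ≠ γ.1) : groupoidD γ f η = 0 := by
  obtain ⟨x, y, a⟩ := γ
  rw [gaux_D_sum]
  refine Finset.sum_eq_zero fun z _ => Finset.sum_eq_zero fun b _ => if_neg ?_
  rintro rfl; exact h rfl

theorem gaux_D_comp (x y z : G) (a : x ⟶ y) (b : y ⟶ z) :
    (groupoidD ⟨x, y, a⟩).comp (groupoidD ⟨y, z, b⟩) = groupoidD ⟨x, z, a ≫ b⟩ := by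
  refine LinearMap.ext fun f => funext fun η => ?_
  obtain ⟨p, q, c⟩ := η
  rw [LinearMap.comp_apply]
  by_cases h : p = x
  · subst h
    simp only [gaux_D_same]
    congr 3
    simp [Groupoid.inv_eq_inv]
  · rw [gaux_D_ne _ _ _ h, gaux_D_ne _ _ _ h]

theorem gaux_D_comp_ne (γ₁ γ₂ : Σ x y : G, x ⟶ y) (hne : γ₁.2.1 ≠ γ₂.1) :
    (groupoidD γ₁).comp (groupoidD γ₂) = 0 := by
  refine LinearMap.ext fun f => funext fun η => ?_
  obtain ⟨p, q, c⟩ := η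
  obtain ⟨x, y, a⟩ := γ₁
  rw [LinearMap.comp_apply]
  by_cases h : p = x
  · subst h
    rw [gaux_D_same, gaux_D_ne _ _ _ hne]
    rfl
  · rw [gaux_D_ne _ _ _ h]
    rfl

theorem gaux_M_mul (γ₁ γ₂ : Σ x y : G, x ⟶ y) :
    groupoidM γ₁ * groupoidM γ₂ = LinearMap.toMatrix (Pi.basisFun ℂ (Σ x y : G, x ⟶ y))
      (Pi.basisFun ℂ (Σ x y : G, x ⟶ y)) ((groupoidD γ₁).comp (groupoidD γ₂)) := by
  unfold groupoidM
  rw [← LinearMap.toMatrix_comp]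

theorem gaux_M_same (x y z : G) (a : x ⟶ y) (c : x ⟶ z) (η : Σ x y : G, x ⟶ y) :
    groupoidM ⟨x, y, a⟩ ⟨x, z, c⟩ η =
      if (⟨y, z, Groupoid.inv a ≫ c⟩ : Σ x y : G, x ⟶ y) = η then 1 else 0 := by
  unfold groupoidM
  rw [LinearMap.toMatrix_apply]
  simp only [Pi.basisFun_apply, Pi.basisFun_repr]
  rw [gaux_D_same, Pi.single_apply]

theorem gaux_M_ne (γ η ζ : Σ x y : G, x ⟶ y) (h : η.1 ≠ γ.1) :
    groupoidM γ η ζ = 0 := by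
  unfold groupoidM
  rw [LinearMap.toMatrix_apply]
  simp only [Pi.basisFun_apply, Pi.basisFun_repr]
  rw [gaux_D_ne _ _ _ h]

theorem gaux_card (hconn : ∀ a b : G, Nonempty (a ⟶ b)) (x₀ x z : G) :
    Fintype.card (x ⟶ z) = Fintype.card (x₀ ⟶ x₀) := by
  obtain ⟨u⟩ := hconn x₀ x
  obtain ⟨v⟩ := hconn z x₀
  refine Fintype.card_congr
    ⟨fun c => u ≫ c ≫ v, fun d => Groupoid.inv u ≫ d ≫ Groupoid.inv v, ?_, ?_⟩
  · intro c; simp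
  · intro c; simp

theorem gaux_trace (hconn : ∀ a b : G, Nonempty (a ⟶ b)) (x₀ : G)
    (γ γ' : Σ x y : G, x ⟶ y) :
    Matrix.trace (groupoidM γ * (groupoidM γ').transpose) =
      if γ = γ' then ((Fintype.card G : ℂ) * (Fintype.card (x₀ ⟶ x₀) : ℂ)) else 0 := by
  obtain ⟨x, y, a⟩ := γ
  simp only [Matrix.trace, Matrix.diag_apply, Matrix.mul_apply, Matrix.transpose_apply]
  rw [Fintype.sum_sigma, Finset.sum_eq_single x]
  · rw [Fintype.sum_sigma]
    have key : ∀ (z : G) (c : x ⟶ z),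
        ∑ ζ, groupoidM ⟨x, y, a⟩ ⟨x, z, c⟩ ζ * groupoidM γ' ⟨x, z, c⟩ ζ =
          if (⟨x, y, a⟩ : Σ x y : G, x ⟶ y) = γ' then (1 : ℂ) else 0 := by
      intro z c
      obtain ⟨x', y', a'⟩ := γ'
      by_cases h : x = x'
      · subst h
        simp only [gaux_M_same, ite_mul, one_mul, zero_mul, Finset.sum_ite_eq,
          Finset.mem_univ, if_true]
        refine if_congr ⟨fun e => ?_, fun e => ?_⟩ rfl rfl
        · have h1 : y' = y := congrArg Sigma.fst e
          subst h1
          simp only [Sigma.mk.injEq, heq_eq_eq, true_and] at e ⊢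
          have := congrArg (fun t => c ≫ Groupoid.inv t) e
          simpa [Groupoid.inv_eq_inv] using this.symm
        · cases e; rfl
      · rw [if_neg (by intro e; cases e; exact h rfl)]
        refine Finset.sum_eq_zero fun ζ _ => ?_
        rw [gaux_M_ne ⟨x', y', a'⟩ _ _ h, mul_zero]
    simp only [key]
    simp only [Finset.sum_const, Finset.card_univ, gaux_card hconn x₀ x]
    split_ifs <;> simp
  · intro p _ h
    refine Finset.sum_eq_zero fun c _ => Finset.sum_eq_zero fun ζ _ => ?_
    rw [gaux_M_ne ⟨x, y, a⟩ _ _ h, zero_mul]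
  · simp

theorem gaux_one (hconn : ∀ a b : G, Nonempty (a ⟶ b)) (x₀ x y z : G)
    (a : x ⟶ y) (b : y ⟶ z) (γ : Σ x y : G, x ⟶ y) :
    (1 / ((Fintype.card G : ℂ) * (Fintype.card (x₀ ⟶ x₀) : ℂ))) *
        Matrix.trace (groupoidM (⟨x, y, a⟩ : Σ x y : G, x ⟶ y) *
          groupoidM ⟨y, z, b⟩ * (groupoidM γ).transpose) =
      if (⟨x, z, a ≫ b⟩ : Σ x y : G, x ⟶ y) = γ then 1 else 0 := by
  rw [gaux_M_mul, gaux_D_comp]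
  change _ * Matrix.trace (groupoidM _ * _) = _
  rw [gaux_trace hconn x₀]
  have h1 : (Fintype.card G : ℂ) ≠ 0 := by
    have : Nonempty G := ⟨x₀⟩
    exact_mod_cast Fintype.card_ne_zero
  have h2 : (Fintype.card (x₀ ⟶ x₀) : ℂ) ≠ 0 := by
    have : Nonempty (x₀ ⟶ x₀) := ⟨𝟙 _⟩
    exact_mod_cast Fintype.card_ne_zero
  split_ifs
  · field_simp
  · simp

theorem gaux_two (x₀ : G) (γ₁ γ₂ γ : Σ x y : G, x ⟶ y) (h : γ₁.2.1 ≠ γ₂.1) :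
    (1 / ((Fintype.card G : ℂ) * (Fintype.card (x₀ ⟶ x₀) : ℂ))) *
      Matrix.trace (groupoidM γ₁ * groupoidM γ₂ * (groupoidM γ).transpose) = 0 := by
  rw [gaux_M_mul, gaux_D_comp_ne _ _ h]
  simp

end Helpers

open Matrix in
/-- For a connected finite groupoid, with
`N = (number of objects) × (order of the isotropy group)`, the star-product kernel
`K(γ₁,γ₂,γ) = (1/N)·Tr[M(γ₁) M(γ₂) M(γ)ᵀ]` equals `1` if `γ₁, γ₂` are composable with
`γ₁ ≫ γ₂ = γ` and `0` otherwise, and consequently the star product defined by this kernel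
coincides with the convolution product of the groupoid algebra. -/
theorem groupoidM_star_kernel_eq_convolution
    {G : Type*} [Groupoid G] [Fintype G] [DecidableEq G]
    [∀ x y : G, Fintype (x ⟶ y)] [∀ x y : G, DecidableEq (x ⟶ y)]
    (hconn : ∀ a b : G, Nonempty (a ⟶ b)) (x₀ : G) :
    (∀ (x y z : G) (a : x ⟶ y) (b : y ⟶ z) (γ : Σ x y : G, x ⟶ y),
        (1 / ((Fintype.card G : ℂ) * (Fintype.card (x₀ ⟶ x₀) : ℂ))) *
            Matrix.trace (groupoidM (⟨x, y, a⟩ : Σ x y : G, x ⟶ y) *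
              groupoidM ⟨y, z, b⟩ * (groupoidM γ)ᵀ) =
          if (⟨x, z, a ≫ b⟩ : Σ x y : G, x ⟶ y) = γ then 1 else 0) ∧
    (∀ γ₁ γ₂ γ : Σ x y : G, x ⟶ y, γ₁.2.1 ≠ γ₂.1 →
        (1 / ((Fintype.card G : ℂ) * (Fintype.card (x₀ ⟶ x₀) : ℂ))) *
            Matrix.trace (groupoidM γ₁ * groupoidM γ₂ * (groupoidM γ)ᵀ) = 0) ∧
    (∀ f₁ f₂ : (Σ x y : G, x ⟶ y) → ℂ,
        (fun γ : Σ x y : G, x ⟶ y => ∑ γ₁ : Σ x y : G, x ⟶ y, ∑ γ₂ : Σ x y : G, x ⟶ y,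
            f₁ γ₁ * f₂ γ₂ *
              ((1 / ((Fintype.card G : ℂ) * (Fintype.card (x₀ ⟶ x₀) : ℂ))) *
                Matrix.trace (groupoidM γ₁ * groupoidM γ₂ * (groupoidM γ)ᵀ))) =
          groupoidConv f₁ f₂) := by
  refine ⟨fun x y z a b γ => gaux_one hconn x₀ x y z a b γ,
    fun γ₁ γ₂ γ h => gaux_two x₀ γ₁ γ₂ γ h, fun f₁ f₂ => funext fun γ => ?_⟩
  unfold groupoidConv
  rw [Fintype.sum_sigma]
  refine Finset.sum_congr rfl fun x _ => ?_
  rw [Fintype.sum_sigma]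
  refine Finset.sum_congr rfl fun y _ => ?_
  rw [Finset.sum_comm (s := (Finset.univ : Finset G))]
  refine Finset.sum_congr rfl fun a _ => ?_
  rw [Fintype.sum_sigma, Finset.sum_eq_single y]
  · rw [Fintype.sum_sigma]
    refine Finset.sum_congr rfl fun z _ => Finset.sum_congr rfl fun b _ => ?_
    rw [gaux_one hconn]
    split_ifs <;> simp
  · intro y' _ h
    refine Finset.sum_eq_zero fun b _ => ?_
    rw [gaux_two x₀ _ _ _ (Ne.symm h), mul_zero]
  · simp
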